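/- Let 0 < β < α ≤ 1 and let (c_n)_{n ≥ 1} be complex numbers. The following are equivalent: (i) the series ∑_{n ≥ 1} c_n e(nx) converges uniformly on ℝ to a function that is Hölder continuous of index β' for every 0 < β' < α; (ii) the series ∑_{n ≥ 1} c_n n^β e(nx) converges uniformly on ℝ to a function that is Hölder continuous of index β' for every 0 < β' < α − β. -/

import Mathlib

open Complex Filter Finset

/-- `e x = exp(2 π i x)` -/
noncomputable def e (t : ℝ) : ℂ := Complex.exp (2 * Real.pi * Complex.I * t)

lemma e_zero : e 0 = 1 := by simp [e]

lemma e_add (s t : ℝ) : e (s + t) = e s * e t := by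
  simp only [e, ← Complex.exp_add]
  congr 1
  push_cast
  ring

lemma e_natCast_mul (n : ℕ) (t : ℝ) : e (n * t) = e t ^ n := by
  simp only [e, ← Complex.exp_nat_mul]
  congr 1
  push_cast
  ring

lemma norm_e (t : ℝ) : ‖e t‖ = 1 := by
  have h : 2 * (Real.pi : ℂ) * Complex.I * t = ((2 * Real.pi * t : ℝ) : ℂ) * Complex.I := by
    push_cast
    ring
  rw [e, h, Complex.norm_exp_ofReal_mul_I]

@[fun_prop]
lemma continuous_e : Continuous e := by
  unfold e
  fun_prop

lemma four_mul_abs_le_norm_e_sub_one {t : ℝ} (ht : |t| ≤ 1 / 2) : 4 * |t| ≤ ‖e t - 1‖ := by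
  have h : e t = Complex.exp (Complex.I * ((2 * Real.pi * t : ℝ) : ℂ)) := by
    rw [e]
    congr 1
    push_cast
    ring
  have hs : |Real.pi * t| ≤ Real.pi / 2 := by
    rw [abs_mul, abs_of_pos Real.pi_pos]
    nlinarith [Real.pi_pos]
  have h2 := Real.mul_abs_le_abs_sin hs
  rw [abs_mul, abs_of_pos Real.pi_pos] at h2
  rw [h, Complex.norm_exp_I_mul_ofReal_sub_one, Real.norm_eq_abs, abs_mul,
    show 2 * Real.pi * t / 2 = Real.pi * t by ring, abs_two]
  have h3 : 2 / Real.pi * (Real.pi * |t|) = 2 * |t| := by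
    field_simp
  linarith

lemma integral_e_intCast_mul (k : ℤ) :
    ∫ t in (-(1 / 2) : ℝ)..(1 / 2), e (k * t) = if k = 0 then 1 else 0 := by
  split_ifs with hk
  · simp only [hk, Int.cast_zero, zero_mul, e_zero, intervalIntegral.integral_const]
    norm_num
  · have hc : (2 * Real.pi * Complex.I * k : ℂ) ≠ 0 := by
      simp [Real.pi_ne_zero, hk]
    have h : ∀ t : ℝ, e (k * t) = Complex.exp ((2 * Real.pi * Complex.I * k) * t) := by
      intro t
      rw [e]
      congr 1
      push_cast
      ring
    simp only [h]
    rw [integral_exp_mul_complex hc, div_eq_zero_iff]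
    left
    rw [sub_eq_zero, Complex.exp_eq_exp_iff_exists_int]
    refine ⟨k, ?_⟩
    push_cast
    ring

/-- Convolution of one exponential with another over a period. -/
lemma integral_e_mul_e (m k : ℤ) (x : ℝ) :
    ∫ t in (-(1 / 2) : ℝ)..(1 / 2), e (m * (x - t)) * e (k * t) =
      if m = k then e (m * x) else 0 := by
  have h : ∀ t : ℝ, e (m * (x - t)) * e (k * t) = e (m * x) * e (((k - m : ℤ) : ℝ) * t) := by
    intro t
    rw [← e_add, ← e_add]
    congr 1
    push_cast
    ring
  simp only [h]
  rw [intervalIntegral.integral_const_mul, integral_e_intCast_mul]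
  simp only [sub_eq_zero, eq_comm (a := k), mul_ite, mul_one, mul_zero]

/-- The geometric sum `∑ e(jt)`, `0 ≤ j < N`. -/
noncomputable def expSum (N : ℕ) (t : ℝ) : ℂ := ∑ j ∈ range N, e (j * t)

@[fun_prop]
lemma continuous_expSum (N : ℕ) : Continuous (expSum N) := by
  unfold expSum
  fun_prop

lemma norm_expSum_le (N : ℕ) (t : ℝ) : ‖expSum N t‖ ≤ N := by
  refine (norm_sum_le _ _).trans ?_
  simp [norm_e]

lemma norm_expSum_mul_abs_le (N : ℕ) {t : ℝ} (ht : |t| ≤ 1 / 2) : ‖expSum N t‖ * |t| ≤ 1 := by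
  have h : expSum N t * (e t - 1) = e t ^ N - 1 := by
    simp only [expSum, e_natCast_mul]
    exact geom_sum_mul _ _
  have h2 : ‖expSum N t‖ * ‖e t - 1‖ ≤ 2 := by
    rw [← norm_mul, h]
    refine (norm_sub_le _ _).trans ?_
    rw [norm_pow, norm_e]
    norm_num
  have h3 := four_mul_abs_le_norm_e_sub_one ht
  nlinarith [norm_nonneg (expSum N t), abs_nonneg t,
    mul_le_mul_of_nonneg_left h3 (norm_nonneg (expSum N t))]

lemma norm_expSum_le_rpow (N : ℕ) {t θ : ℝ} (ht : |t| ≤ 1 / 2) (ht0 : t ≠ 0) (h0 : 0 ≤ θ)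
    (h1 : θ ≤ 1) : ‖expSum N t‖ ≤ (N : ℝ) ^ θ * |t| ^ (θ - 1) := by
  have hp : 0 < |t| := abs_pos.2 ht0
  have h2 : ‖expSum N t‖ ≤ |t|⁻¹ := by
    rw [← one_div, le_div_iff₀ hp]
    exact norm_expSum_mul_abs_le N ht
  calc ‖expSum N t‖ = ‖expSum N t‖ ^ θ * ‖expSum N t‖ ^ (1 - θ) := by
        rw [← Real.rpow_add_of_nonneg (norm_nonneg _) h0 (by linarith)]
        simp
    _ ≤ (N : ℝ) ^ θ * (|t|⁻¹) ^ (1 - θ) := by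
        gcongr
        exact norm_expSum_le N t
    _ = (N : ℝ) ^ θ * |t| ^ (θ - 1) := by
        rw [Real.inv_rpow hp.le, ← Real.rpow_neg hp.le, neg_sub]

lemma intervalIntegrable_abs_rpow {p : ℝ} (hp : -1 < p) (a : ℝ) :
    IntervalIntegrable (fun t : ℝ => |t| ^ p) MeasureTheory.volume (-a) a := by
  have key : ∀ b : ℝ, 0 ≤ b →
      IntervalIntegrable (fun t : ℝ => |t| ^ p) MeasureTheory.volume 0 b := by
    intro b hb
    refine (intervalIntegral.intervalIntegrable_rpow' (a := 0) (b := b) hp).congr ?_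
    intro t ht
    rw [Set.uIoc_of_le hb] at ht
    simp only [abs_of_pos ht.1]
  have key' : ∀ b : ℝ, IntervalIntegrable (fun t : ℝ => |t| ^ p) MeasureTheory.volume 0 b := by
    intro b
    rcases le_total 0 b with hb | hb
    · exact key b hb
    · rw [IntervalIntegrable.iff_comp_neg, neg_zero]
      simpa only [abs_neg] using key (-b) (by linarith)
  exact (key' (-a)).symm.trans (key' a)

/-- The Fejér kernel. -/
noncomputable def fejer (N : ℕ) (t : ℝ) : ℂ := (N : ℂ)⁻¹ * (expSum N t * expSum N (-t))

@[fun_prop]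
lemma continuous_fejer (N : ℕ) : Continuous (fejer N) := by
  unfold fejer
  fun_prop

lemma fejer_eq_sum (N : ℕ) (t : ℝ) :
    fejer N t = (N : ℂ)⁻¹ * ∑ p ∈ range N ×ˢ range N, e ((((p.1 : ℤ) - p.2 : ℤ) : ℝ) * t) := by
  rw [fejer, expSum, expSum, sum_mul_sum, sum_product]
  congr 1
  refine sum_congr rfl fun i _ => sum_congr rfl fun j _ => ?_
  rw [← e_add]
  congr 1
  push_cast
  ring

lemma integral_mul_sum_e {ι : Type*} (s : Finset ι) (k : ι → ℤ) {φ : ℝ → ℂ} (hφ : Continuous φ) :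
    ∫ t in (-(1 / 2) : ℝ)..(1 / 2), φ t * ∑ i ∈ s, e (k i * t) =
      ∑ i ∈ s, ∫ t in (-(1 / 2) : ℝ)..(1 / 2), φ t * e (k i * t) := by
  simp only [mul_sum]
  refine intervalIntegral.integral_finsetSum fun i _ => ?_
  exact Continuous.intervalIntegrable (by fun_prop) _ _

lemma integral_fejer {N : ℕ} (hN : N ≠ 0) :
    ∫ t in (-(1 / 2) : ℝ)..(1 / 2), fejer N t = 1 := by
  have h := integral_mul_sum_e (range N ×ˢ range N) (fun p => (p.1 : ℤ) - p.2)
    (continuous_const (y := (1 : ℂ)))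
  simp only [one_mul, integral_e_intCast_mul, sub_eq_zero, Nat.cast_inj] at h
  simp only [fejer_eq_sum]
  rw [intervalIntegral.integral_const_mul, h, sum_product]
  have : ∀ i ∈ range N, ∑ j ∈ range N, (if i = j then (1 : ℂ) else 0) = 1 := by
    intro i hi
    rw [sum_ite_eq, if_pos hi]
  rw [sum_congr rfl this]
  simp [hN]

lemma norm_fejer_le_rpow {N : ℕ} (hN : N ≠ 0) {t θ : ℝ} (ht : |t| ≤ 1 / 2) (ht0 : t ≠ 0)
    (h0 : 0 ≤ θ) (h1 : θ ≤ 1) :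
    ‖fejer N t‖ ≤ (N : ℝ) ^ (2 * θ - 1) * |t| ^ (2 * θ - 2) := by
  have hp : 0 < |t| := abs_pos.2 ht0
  have hN' : (0 : ℝ) < N := by positivity
  have h2 := norm_expSum_le_rpow N ht ht0 h0 h1
  have h3 := norm_expSum_le_rpow N (t := -t) (by rwa [abs_neg]) (neg_ne_zero.2 ht0) h0 h1
  rw [abs_neg] at h3
  calc ‖fejer N t‖ = (N : ℝ)⁻¹ * (‖expSum N t‖ * ‖expSum N (-t)‖) := by simp [fejer]
    _ ≤ (N : ℝ)⁻¹ * (((N : ℝ) ^ θ * |t| ^ (θ - 1)) * ((N : ℝ) ^ θ * |t| ^ (θ - 1))) := by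
        gcongr
    _ = ((N : ℝ) ^ (-1 : ℝ) * (N : ℝ) ^ θ * (N : ℝ) ^ θ) * (|t| ^ (θ - 1) * |t| ^ (θ - 1)) := by
        rw [Real.rpow_neg_one]
        ring
    _ = (N : ℝ) ^ (2 * θ - 1) * |t| ^ (2 * θ - 2) := by
        rw [← Real.rpow_add hN', ← Real.rpow_add hN', ← Real.rpow_add hp]
        ring_nf

/-- The Fourier coefficients of a uniformly convergent series `∑ c_n e(nx)`, `n ≥ 1`, are read off
by convolution with exponentials. -/
lemma integral_mul_e_of_tendstoUniformly {c : ℕ → ℂ} {f : ℝ → ℂ}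
    (hf : TendstoUniformly (fun N x => ∑ n ∈ Finset.Icc 1 N, c n * e ((n : ℝ) * x)) f atTop)
    (k : ℤ) (x : ℝ) :
    ∫ t in (-(1 / 2) : ℝ)..(1 / 2), f (x - t) * e (k * t) =
      if 1 ≤ k then c k.toNat * e (k * x) else 0 := by
  have hS : ∀ N : ℕ, Continuous fun x : ℝ => ∑ n ∈ Finset.Icc 1 N, c n * e ((n : ℝ) * x) := by
    intro N
    fun_prop
  have hlim : TendstoUniformly
      (fun N t => (∑ n ∈ Finset.Icc 1 N, c n * e ((n : ℝ) * (x - t))) * e (k * t))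
      (fun t => f (x - t) * e (k * t)) atTop := by
    rw [Metric.tendstoUniformly_iff] at hf ⊢
    intro ε hε
    filter_upwards [hf ε hε] with N hN t
    rw [dist_eq_norm, ← sub_mul, norm_mul, norm_e, mul_one, ← dist_eq_norm]
    exact hN (x - t)
  have h1 := TendstoUniformlyOn.tendsto_intervalIntegral_of_continuousOn
    (a := -(1 / 2)) (b := 1 / 2) (μ := MeasureTheory.volume)
    (Eventually.of_forall fun N : ℕ => Continuous.continuousOn (by have := hS N; fun_prop))
    hlim.tendstoUniformlyOn
  refine tendsto_nhds_unique h1 (tendsto_const_nhds.congr' ?_)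
  filter_upwards [eventually_ge_atTop k.toNat] with N hN
  have h2 : ∀ n ∈ Finset.Icc 1 N, ∫ t in (-(1 / 2) : ℝ)..(1 / 2),
      c n * (e (n * (x - t)) * e (k * t)) = if (n : ℤ) = k then c n * e (n * x) else 0 := by
    intro n _
    have := integral_e_mul_e n k x
    simp only [Int.cast_natCast] at this
    rw [intervalIntegral.integral_const_mul, this, mul_ite, mul_zero]
  simp only [sum_mul, mul_assoc]
  rw [intervalIntegral.integral_finsetSum, sum_congr rfl h2]
  · split_ifs with hk
    · lift k to ℕ using by omega
      simp only [Nat.cast_inj, Int.toNat_natCast, Int.cast_natCast] at hN hk ⊢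
      rw [sum_ite_eq', if_pos]
      simp only [Finset.mem_Icc]
      omega
    · refine (sum_eq_zero fun n hn => if_neg ?_).symm
      rw [Finset.mem_Icc] at hn
      omega
  · intro n _
    exact Continuous.intervalIntegrable (by fun_prop) _ _

/-- The Fejér mean of `∑ c_n e(nx)`, `n ≥ 1`. -/
noncomputable def fejerMean (c : ℕ → ℂ) (N : ℕ) (x : ℝ) : ℂ :=
  (N : ℂ)⁻¹ * ∑ p ∈ range N ×ˢ range N,
    if 1 ≤ (p.1 : ℤ) - p.2 then
      c ((p.1 : ℤ) - p.2).toNat * e ((((p.1 : ℤ) - p.2 : ℤ) : ℝ) * x) else 0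

@[fun_prop]
lemma continuous_fejerMean (c : ℕ → ℂ) (N : ℕ) : Continuous (fejerMean c N) := by
  unfold fejerMean
  refine continuous_const.mul (continuous_finsetSum _ fun p _ => ?_)
  split_ifs <;> fun_prop

lemma continuous_of_tendstoUniformly {c : ℕ → ℂ} {f : ℝ → ℂ}
    (hf : TendstoUniformly (fun N x => ∑ n ∈ Finset.Icc 1 N, c n * e ((n : ℝ) * x)) f atTop) :
    Continuous f :=
  hf.continuous (Frequently.of_forall fun N => by fun_prop)

lemma integral_mul_fejer {c : ℕ → ℂ} {f : ℝ → ℂ}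
    (hf : TendstoUniformly (fun N x => ∑ n ∈ Finset.Icc 1 N, c n * e ((n : ℝ) * x)) f atTop)
    (N : ℕ) (x : ℝ) :
    ∫ t in (-(1 / 2) : ℝ)..(1 / 2), f (x - t) * fejer N t = fejerMean c N x := by
  have hfc := continuous_of_tendstoUniformly hf
  have h := integral_mul_sum_e (range N ×ˢ range N) (fun p => (p.1 : ℤ) - p.2)
    (φ := fun t => f (x - t)) (by fun_prop)
  simp only [integral_mul_e_of_tendstoUniformly hf] at h
  simp only [fejer_eq_sum, mul_left_comm (f _)]
  rw [intervalIntegral.integral_const_mul, h, fejerMean]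

/-- Convolution with `∑ e(kt)`, `1 ≤ k ≤ N`, fixes Fejér means of order `N`. -/
lemma integral_fejerMean_mul_sum_e (c : ℕ → ℂ) (N : ℕ) (x : ℝ) :
    ∫ t in (-(1 / 2) : ℝ)..(1 / 2), fejerMean c N (x - t) * ∑ k ∈ Finset.Icc 1 N,
      e (((k : ℤ) : ℝ) * t) = fejerMean c N x := by
  rw [integral_mul_sum_e (Finset.Icc 1 N) (fun k => (k : ℤ)) (by fun_prop)]
  have h : ∀ k ∈ Finset.Icc 1 N,
      ∫ t in (-(1 / 2) : ℝ)..(1 / 2), fejerMean c N (x - t) * e (((k : ℤ) : ℝ) * t) =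
      (N : ℂ)⁻¹ * ∑ p ∈ range N ×ˢ range N, if (p.1 : ℤ) - p.2 = k then
        c ((p.1 : ℤ) - p.2).toNat * e ((((p.1 : ℤ) - p.2 : ℤ) : ℝ) * x) else 0 := by
    intro k hk
    rw [Finset.mem_Icc] at hk
    simp only [fejerMean, mul_assoc, sum_mul]
    rw [intervalIntegral.integral_const_mul, intervalIntegral.integral_finsetSum]
    · congr 1
      refine sum_congr rfl fun p _ => ?_
      by_cases hp : 1 ≤ (p.1 : ℤ) - p.2
      · simp only [if_pos hp, mul_assoc]
        rw [intervalIntegral.integral_const_mul, integral_e_mul_e, mul_ite, mul_zero]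
      · simp only [if_neg hp, zero_mul, intervalIntegral.integral_zero]
        rw [if_neg (by omega)]
    · intro p _
      refine Continuous.intervalIntegrable ?_ _ _
      split_ifs <;> fun_prop
  rw [sum_congr rfl h, ← mul_sum, sum_comm, fejerMean]
  congr 1
  refine sum_congr rfl fun p hp => ?_
  simp only [mem_product, Finset.mem_range] at hp
  split_ifs with h1
  · rw [sum_eq_single ((p.1 : ℤ) - p.2).toNat, if_pos (by omega)]
    · intro b _ hb
      exact if_neg (by omega)
    · intro hmem
      rw [Finset.mem_Icc] at hmem
      omega
  · refine sum_eq_zero fun k hk => if_neg ?_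
    rw [Finset.mem_Icc] at hk
    omega

lemma norm_sub_fejerMean_le {c : ℕ → ℂ} {f : ℝ → ℂ}
    (hf : TendstoUniformly (fun N x => ∑ n ∈ Finset.Icc 1 N, c n * e ((n : ℝ) * x)) f atTop)
    {γ H θ : ℝ} (hH : ∀ x y, ‖f x - f y‖ ≤ H * |x - y| ^ γ) (h0 : 0 ≤ θ) (h1 : θ ≤ 1)
    (hθ : 1 < γ + 2 * θ) {N : ℕ} (hN : N ≠ 0) (x : ℝ) :
    ‖f x - fejerMean c N x‖ ≤ (N : ℝ) ^ (2 * θ - 1) *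
      (H * ∫ t in (-(1 / 2) : ℝ)..(1 / 2), |t| ^ (γ + 2 * θ - 2)) := by
  have hfc := continuous_of_tendstoUniformly hf
  have h2 : f x - fejerMean c N x =
      ∫ t in (-(1 / 2) : ℝ)..(1 / 2), (f x - f (x - t)) * fejer N t := by
    simp only [sub_mul]
    rw [intervalIntegral.integral_sub, integral_mul_fejer hf, intervalIntegral.integral_const_mul,
      integral_fejer hN, mul_one]
    all_goals exact Continuous.intervalIntegrable (by fun_prop) _ _
  rw [h2, ← intervalIntegral.integral_const_mul, ← intervalIntegral.integral_const_mul]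
  refine intervalIntegral.norm_integral_le_of_norm_le (by norm_num) ?_
    (((intervalIntegrable_abs_rpow (by linarith) _).const_mul _).const_mul _)
  filter_upwards [MeasureTheory.Measure.ae_ne MeasureTheory.volume 0] with t ht0 ht
  have hp : 0 < |t| := abs_pos.2 ht0
  have h3 := hH x (x - t)
  rw [sub_sub_cancel] at h3
  have h4 := norm_fejer_le_rpow hN (abs_le.2 ⟨ht.1.le, ht.2⟩) ht0 h0 h1
  calc ‖(f x - f (x - t)) * fejer N t‖
      ≤ (H * |t| ^ γ) * ((N : ℝ) ^ (2 * θ - 1) * |t| ^ (2 * θ - 2)) := by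
        rw [norm_mul]
        exact mul_le_mul h3 h4 (norm_nonneg _) ((norm_nonneg _).trans h3)
    _ = (N : ℝ) ^ (2 * θ - 1) * (H * (|t| ^ γ * |t| ^ (2 * θ - 2))) := by ring
    _ = _ := by
        rw [← Real.rpow_add hp]
        ring_nf

lemma norm_sum_e_le_rpow (N : ℕ) {t θ : ℝ} (ht : |t| ≤ 1 / 2) (ht0 : t ≠ 0) (h0 : 0 ≤ θ)
    (h1 : θ ≤ 1) :
    ‖∑ k ∈ Finset.Icc 1 N, e (((k : ℤ) : ℝ) * t)‖ ≤ (N : ℝ) ^ θ * |t| ^ (θ - 1) := by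
  have h : ∑ k ∈ Finset.Icc 1 N, e (((k : ℤ) : ℝ) * t) = e t * expSum N t := by
    rw [expSum, mul_sum, range_eq_Ico, ← Finset.Ico_add_one_right_eq_Icc, sum_Ico_eq_sum_range,
      sum_Ico_eq_sum_range]
    refine sum_congr (by simp) fun j _ => ?_
    rw [← e_add]
    congr 1
    push_cast
    ring
  rw [h, norm_mul, norm_e, one_mul]
  exact norm_expSum_le_rpow N ht ht0 h0 h1

/-- Partial sums of the Fourier series of a Hölder function of index `γ` approximate it to order
`N ^ (-γ')` for every `γ' < γ`. -/
lemma exists_norm_sub_sum_le_of_holder {c : ℕ → ℂ} {f : ℝ → ℂ}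
    (hf : TendstoUniformly (fun N x => ∑ n ∈ Finset.Icc 1 N, c n * e ((n : ℝ) * x)) f atTop)
    {γ γ' H : ℝ} (hγ' : 0 < γ') (hγγ' : γ' < γ) (hγ1 : γ ≤ 1)
    (hH : ∀ x y, ‖f x - f y‖ ≤ H * |x - y| ^ γ) :
    ∃ C : ℝ, ∀ N : ℕ, N ≠ 0 → ∀ x : ℝ,
      ‖f x - ∑ n ∈ Finset.Icc 1 N, c n * e (n * x)‖ ≤ C * (N : ℝ) ^ (-γ') := by
  have hfc := continuous_of_tendstoUniformly hf
  obtain ⟨η, hη⟩ : ∃ η, η = (γ - γ') / 2 := ⟨_, rfl⟩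
  obtain ⟨θ, hθ⟩ : ∃ θ, θ = (1 - γ + η) / 2 := ⟨_, rfl⟩
  obtain ⟨B, hB⟩ : ∃ B, B = H * ∫ t in (-(1 / 2) : ℝ)..(1 / 2), |t| ^ (γ + 2 * θ - 2) :=
    ⟨_, rfl⟩
  obtain ⟨A, hA⟩ : ∃ A, A = ∫ t in (-(1 / 2) : ℝ)..(1 / 2), |t| ^ (η - 1) := ⟨_, rfl⟩
  refine ⟨B * A + B, fun N hN x => ?_⟩
  have hN' : (1 : ℝ) ≤ N := by exact_mod_cast Nat.one_le_iff_ne_zero.2 hN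
  have hN0 : (0 : ℝ) < N := by linarith
  have h1 : ∀ y, ‖f y - fejerMean c N y‖ ≤ (N : ℝ) ^ (2 * θ - 1) * B := fun y => by
    rw [hB]
    exact norm_sub_fejerMean_le hf hH (by linarith) (by linarith) (by linarith) hN y
  have hB0 : 0 ≤ B := by
    have := (norm_nonneg _).trans (h1 0)
    have hp : 0 < (N : ℝ) ^ (2 * θ - 1) := Real.rpow_pos_of_pos hN0 _
    exact nonneg_of_mul_nonneg_right this hp
  have h2 : (∑ n ∈ Finset.Icc 1 N, c n * e (n * x)) - fejerMean c N x =
      ∫ t in (-(1 / 2) : ℝ)..(1 / 2), (f (x - t) - fejerMean c N (x - t)) *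
        ∑ k ∈ Finset.Icc 1 N, e (((k : ℤ) : ℝ) * t) := by
    simp only [sub_mul]
    rw [intervalIntegral.integral_sub, integral_fejerMean_mul_sum_e,
      integral_mul_sum_e (Finset.Icc 1 N) (fun k => (k : ℤ)) (by fun_prop)]
    · congr 1
      refine sum_congr rfl fun k hk => ?_
      rw [Finset.mem_Icc] at hk
      rw [integral_mul_e_of_tendstoUniformly hf, if_pos (by omega)]
      simp
    all_goals exact Continuous.intervalIntegrable (by fun_prop) _ _
  have h3 : ‖(∑ n ∈ Finset.Icc 1 N, c n * e (n * x)) - fejerMean c N x‖ ≤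
      (N : ℝ) ^ (2 * θ - 1) * B * ((N : ℝ) ^ η * A) := by
    rw [h2, hA, ← intervalIntegral.integral_const_mul, ← intervalIntegral.integral_const_mul]
    refine intervalIntegral.norm_integral_le_of_norm_le (by norm_num) ?_
      (((intervalIntegrable_abs_rpow (by linarith) _).const_mul _).const_mul _)
    filter_upwards [MeasureTheory.Measure.ae_ne MeasureTheory.volume 0] with t ht0 ht
    rw [norm_mul]
    exact mul_le_mul (h1 _) (norm_sum_e_le_rpow N (abs_le.2 ⟨ht.1.le, ht.2⟩) ht0
      (by linarith) (by linarith)) (norm_nonneg _) (by positivity)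
  calc ‖f x - ∑ n ∈ Finset.Icc 1 N, c n * e (n * x)‖
      = ‖(f x - fejerMean c N x) -
          ((∑ n ∈ Finset.Icc 1 N, c n * e (n * x)) - fejerMean c N x)‖ := by
        congr 1
        ring
    _ ≤ (N : ℝ) ^ (2 * θ - 1) * B + (N : ℝ) ^ (2 * θ - 1) * B * ((N : ℝ) ^ η * A) :=
        (norm_sub_le _ _).trans (add_le_add (h1 x) h3)
    _ = (N : ℝ) ^ (2 * θ - 1) * B + (N : ℝ) ^ (-γ') * (B * A) := by
        rw [show -γ' = 2 * θ - 1 + η by linarith, Real.rpow_add hN0]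
        ring
    _ ≤ (N : ℝ) ^ (-γ') * B + (N : ℝ) ^ (-γ') * (B * A) := by
        gcongr
        linarith
    _ = _ := by ring

lemma Ioc_zero_eq_Icc_one (N : ℕ) : Ioc 0 N = Finset.Icc 1 N := by
  ext n
  simp only [Finset.mem_Ioc, Finset.mem_Icc]
  omega

lemma sum_Ioc_mul_eq_sub_add_sum (a w : ℕ → ℂ) (L : ℂ) {M N : ℕ} (hMN : M ≤ N) :
    ∑ n ∈ Ioc M N, w n * a n =
      w M * (L - ∑ n ∈ Finset.Icc 1 M, a n) - w N * (L - ∑ n ∈ Finset.Icc 1 N, a n) +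
        ∑ n ∈ Ico M N, (w (n + 1) - w n) * (L - ∑ k ∈ Finset.Icc 1 n, a k) := by
  induction N, hMN using Nat.le_induction with
  | base => simp
  | succ N hMN ih =>
    rw [← Finset.insert_Ioc_right_eq_Ioc_add_one hMN, sum_insert (by simp), ih,
      sum_Ico_succ_top hMN, sum_Icc_succ_top (by omega)]
    ring

lemma abs_one_add_rpow_sub_one_le {u s : ℝ} (hu : 0 ≤ u) (hs : |s| ≤ 1) :
    |(1 + u) ^ s - 1| ≤ u := by
  have key : ∀ r : ℝ, 0 ≤ r → r ≤ 1 → 1 ≤ (1 + u) ^ r ∧ (1 + u) ^ r ≤ 1 + u := by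
    intro r h0 h1
    refine ⟨Real.one_le_rpow (by linarith) h0, ?_⟩
    simpa using Real.rpow_le_rpow_of_exponent_le (by linarith : 1 ≤ 1 + u) h1
  rcases le_total 0 s with h | h
  · obtain ⟨h1, h2⟩ := key s h (le_of_abs_le hs)
    rw [abs_of_nonneg (by linarith)]
    linarith
  · obtain ⟨h1, h2⟩ := key (-s) (by linarith) (by linarith [neg_le_of_abs_le hs])
    have h3 : (1 + u) ^ s * (1 + u) ^ (-s) = 1 := by
      rw [← Real.rpow_add (by linarith)]
      simp
    have h4 : 0 < (1 + u) ^ s := Real.rpow_pos_of_pos (by linarith) _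
    rw [abs_le]
    constructor <;> nlinarith

lemma abs_add_one_rpow_sub_le {x s : ℝ} (hx : 0 < x) (hs : |s| ≤ 1) :
    |(x + 1) ^ s - x ^ s| ≤ x ^ (s - 1) := by
  have h : (x + 1) ^ s - x ^ s = x ^ s * ((1 + x⁻¹) ^ s - 1) := by
    rw [mul_sub, ← Real.mul_rpow hx.le (by positivity), mul_one, mul_add,
      mul_inv_cancel₀ hx.ne', mul_one]
  rw [h, abs_mul, abs_of_pos (Real.rpow_pos_of_pos hx s), Real.rpow_sub_one hx.ne',
    div_eq_mul_inv]
  gcongr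
  exact abs_one_add_rpow_sub_one_le (by positivity) hs

lemma rpow_neg_sub_one_le {x δ : ℝ} (hx : 1 ≤ x) (hδ : 0 < δ) :
    x ^ (-δ - 1) ≤ (2 + δ) / δ * (x ^ (-δ) - (x + 1) ^ (-δ)) := by
  have hx0 : 0 < x := by linarith
  obtain ⟨u, hu⟩ : ∃ u, u = x⁻¹ := ⟨_, rfl⟩
  have hu0 : 0 < u := by rw [hu]; positivity
  have hu1 : u ≤ 1 := by rw [hu]; exact inv_le_one_of_one_le₀ hx
  have hlog : u / 2 ≤ Real.log (1 + u) := by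
    refine le_trans ?_ (Real.one_sub_inv_le_log_of_pos (by linarith : 0 < 1 + u))
    rw [show 1 - (1 + u)⁻¹ = u / (1 + u) by field_simp; ring]
    gcongr
    linarith
  have h1 : 1 + δ * u / 2 ≤ (1 + u) ^ δ := by
    rw [Real.rpow_def_of_pos (by linarith)]
    have := Real.add_one_le_exp (Real.log (1 + u) * δ)
    nlinarith
  have h2 : (1 + u) ^ (-δ) ≤ 1 - δ / (2 + δ) * u := by
    rw [Real.rpow_neg (by linarith)]
    refine (inv_anti₀ (by positivity) h1).trans ?_
    rw [inv_le_iff_one_le_mul₀ (by positivity)]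
    have : (1 - δ / (2 + δ) * u) * (1 + δ * u / 2) - 1 =
        δ ^ 2 * u * (1 - u) / (2 * (2 + δ)) := by
      field_simp
      ring
    have h3 : 0 ≤ δ ^ 2 * u * (1 - u) / (2 * (2 + δ)) := by
      have : 0 ≤ 1 - u := by linarith
      positivity
    linarith
  have h : (x + 1) ^ (-δ) = x ^ (-δ) * (1 + u) ^ (-δ) := by
    rw [← Real.mul_rpow hx0.le (by positivity), mul_add, hu, mul_inv_cancel₀ hx0.ne', mul_one]
  rw [h, Real.rpow_sub_one hx0.ne', div_eq_mul_inv, ← hu, ← mul_one_sub, mul_left_comm]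
  gcongr
  have h4 : (2 + δ) / δ * (δ / (2 + δ) * u) = u := by
    field_simp
  calc u = (2 + δ) / δ * (δ / (2 + δ) * u) := h4.symm
    _ ≤ _ := by
      gcongr
      linarith

lemma sum_Ico_rpow_neg_sub_one_le {δ : ℝ} (hδ : 0 < δ) {M N : ℕ} (hM : M ≠ 0) (hMN : M ≤ N) :
    ∑ n ∈ Ico M N, (n : ℝ) ^ (-δ - 1) ≤ (2 + δ) / δ * (M : ℝ) ^ (-δ) := by
  have h : ∑ n ∈ Ico M N, (n : ℝ) ^ (-δ - 1) ≤
      (2 + δ) / δ * ((M : ℝ) ^ (-δ) - (N : ℝ) ^ (-δ)) := by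
    induction N, hMN using Nat.le_induction with
    | base => simp
    | succ N hMN ih =>
      have hN : (1 : ℝ) ≤ N := by exact_mod_cast (by omega : 1 ≤ N)
      have := rpow_neg_sub_one_le hN hδ
      rw [sum_Ico_succ_top hMN]
      push_cast
      linarith
  refine h.trans ?_
  gcongr
  exact sub_le_self _ (by positivity)

lemma sum_range_add_one_rpow_neg_le {γ : ℝ} (h0 : 0 ≤ γ) (h1 : γ < 1) (N : ℕ) :
    ∑ n ∈ range N, ((n : ℝ) + 1) ^ (-γ) ≤ (N : ℝ) ^ (1 - γ) / (1 - γ) := by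
  induction N with
  | zero => simp [Real.zero_rpow (by linarith : (1 - γ) ≠ 0)]
  | succ N ih =>
    rw [sum_range_succ]
    have hx : (0 : ℝ) < N + 1 := by positivity
    have h2 := rpow_one_add_le_one_add_mul_self (s := -((N : ℝ) + 1)⁻¹) (p := 1 - γ)
      (neg_le_neg (inv_le_one_of_one_le₀ (by linarith [N.cast_nonneg (α := ℝ)])))
      (by linarith) (by linarith)
    have h3 : (N : ℝ) = (N + 1) * (1 + -((N : ℝ) + 1)⁻¹) := by
      field_simp
      ring
    have h5 : 0 ≤ 1 + -((N : ℝ) + 1)⁻¹ := by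
      have := inv_le_one_of_one_le₀ (by linarith [N.cast_nonneg (α := ℝ)] : 1 ≤ (N : ℝ) + 1)
      linarith
    have h4 : (N : ℝ) ^ (1 - γ) ≤
        ((N : ℝ) + 1) ^ (1 - γ) * (1 + (1 - γ) * -((N : ℝ) + 1)⁻¹) := by
      conv_lhs => rw [h3, Real.mul_rpow hx.le h5]
      gcongr
    have h6 : ((N : ℝ) + 1) ^ (-γ) = ((N : ℝ) + 1) ^ (1 - γ) * ((N : ℝ) + 1)⁻¹ := by
      rw [← div_eq_mul_inv, ← Real.rpow_sub_one hx.ne']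
      ring_nf
    have h7 : 0 < 1 - γ := by linarith
    push_cast
    rw [le_div_iff₀ h7] at ih ⊢
    rw [add_mul]
    have h8 : ((N : ℝ) + 1) ^ (-γ) * (1 - γ) =
        ((N : ℝ) + 1) ^ (1 - γ) * ((1 - γ) * ((N : ℝ) + 1)⁻¹) := by
      rw [h6]
      ring
    linarith

/-- Multiplying the terms of a series with tails `O(n ^ (-γ))` by `n ^ s` with `s < γ`. -/
lemma norm_sum_Ioc_rpow_mul_le {a : ℕ → ℂ} {L : ℂ} {C γ s : ℝ} (hs : |s| ≤ 1) (hsγ : s < γ)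
    (ha : ∀ n : ℕ, n ≠ 0 → ‖L - ∑ k ∈ Finset.Icc 1 n, a k‖ ≤ C * (n : ℝ) ^ (-γ))
    {M N : ℕ} (hM : M ≠ 0) (hMN : M ≤ N) :
    ‖∑ n ∈ Ioc M N, (((n : ℝ) ^ s : ℝ) : ℂ) * a n‖ ≤
      C * (2 + (2 + (γ - s)) / (γ - s)) * (M : ℝ) ^ (-(γ - s)) := by
  have hδ : 0 < γ - s := by linarith
  have hC : 0 ≤ C := by
    have := (norm_nonneg _).trans (ha 1 one_ne_zero)
    simpa using this
  have hpos : ∀ n : ℕ, n ≠ 0 → (0 : ℝ) < n := fun n hn => by positivity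
  have h1 : ∀ n : ℕ, n ≠ 0 →
      ‖(((n : ℝ) ^ s : ℝ) : ℂ) * (L - ∑ k ∈ Finset.Icc 1 n, a k)‖ ≤
        C * (n : ℝ) ^ (-(γ - s)) := by
    intro n hn
    rw [norm_mul, Complex.norm_real, Real.norm_of_nonneg (by positivity)]
    calc (n : ℝ) ^ s * ‖L - ∑ k ∈ Finset.Icc 1 n, a k‖
        ≤ (n : ℝ) ^ s * (C * (n : ℝ) ^ (-γ)) := by
          gcongr
          exact ha n hn
      _ = C * ((n : ℝ) ^ s * (n : ℝ) ^ (-γ)) := by ring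
      _ = _ := by
        rw [← Real.rpow_add (hpos n hn)]
        ring_nf
  have h2 : ∀ n ∈ Ico M N,
      ‖((((n + 1 : ℕ) : ℝ) ^ s : ℝ) - (((n : ℝ) ^ s : ℝ) : ℂ)) *
        (L - ∑ k ∈ Finset.Icc 1 n, a k)‖ ≤ C * (n : ℝ) ^ (-(γ - s) - 1) := by
    intro n hn
    have hn0 : n ≠ 0 := by
      rw [Finset.mem_Ico] at hn
      omega
    rw [norm_mul, ← Complex.ofReal_sub, Complex.norm_real, Real.norm_eq_abs]
    push_cast
    calc |((n : ℝ) + 1) ^ s - (n : ℝ) ^ s| * ‖L - ∑ k ∈ Finset.Icc 1 n, a k‖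
        ≤ (n : ℝ) ^ (s - 1) * (C * (n : ℝ) ^ (-γ)) :=
          mul_le_mul (abs_add_one_rpow_sub_le (hpos n hn0) hs) (ha n hn0) (norm_nonneg _)
            (by positivity)
      _ = C * ((n : ℝ) ^ (s - 1) * (n : ℝ) ^ (-γ)) := by ring
      _ = _ := by
        rw [← Real.rpow_add (hpos n hn0)]
        ring_nf
  have h3 : ((N : ℝ)) ^ (-(γ - s)) ≤ (M : ℝ) ^ (-(γ - s)) :=
    Real.rpow_le_rpow_of_nonpos (hpos M hM) (by exact_mod_cast hMN) (by linarith)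
  have h4 := sum_Ico_rpow_neg_sub_one_le hδ hM hMN
  have h5 : ‖∑ n ∈ Ico M N, ((((n + 1 : ℕ) : ℝ) ^ s : ℝ) - (((n : ℝ) ^ s : ℝ) : ℂ)) *
        (L - ∑ k ∈ Finset.Icc 1 n, a k)‖ ≤
      C * ((2 + (γ - s)) / (γ - s) * (M : ℝ) ^ (-(γ - s))) := by
    refine (norm_sum_le_of_le _ h2).trans ?_
    rw [← mul_sum]
    gcongr
  rw [sum_Ioc_mul_eq_sub_add_sum a (fun n : ℕ => (((n : ℝ) ^ s : ℝ) : ℂ)) L hMN]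
  refine (norm_add_le _ _).trans ?_
  refine (add_le_add ((norm_sub_le _ _).trans (add_le_add (h1 M hM) (h1 N (by omega)))) h5).trans ?_
  have h6 := mul_le_mul_of_nonneg_left h3 hC
  linarith

lemma norm_sum_Icc_natCast_mul_le {a : ℕ → ℂ} {L : ℂ} {C γ : ℝ} (h0 : 0 ≤ γ) (h1 : γ < 1)
    (ha : ∀ n : ℕ, ‖L - ∑ k ∈ Finset.Icc 1 n, a k‖ ≤ C * ((n : ℝ) + 1) ^ (-γ)) {N : ℕ}
    (hN : N ≠ 0) :
    ‖∑ n ∈ Finset.Icc 1 N, (n : ℂ) * a n‖ ≤ C * (1 + 1 / (1 - γ)) * (N : ℝ) ^ (1 - γ) := by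
  have hN0 : (0 : ℝ) < N := by positivity
  have hC : 0 ≤ C := by
    have := (norm_nonneg _).trans (ha 0)
    simpa using this
  have h := sum_Ioc_mul_eq_sub_add_sum a (fun n : ℕ => (n : ℂ)) L N.zero_le
  rw [Ioc_zero_eq_Icc_one] at h
  simp only [Nat.cast_zero, zero_mul, zero_sub, Nat.cast_add, Nat.cast_one, add_sub_cancel_left,
    one_mul, ← range_eq_Ico] at h
  rw [h]
  refine (norm_add_le _ _).trans ?_
  rw [norm_neg, norm_mul, Complex.norm_natCast]
  have h3 : (N : ℝ) * ‖L - ∑ n ∈ Finset.Icc 1 N, a n‖ ≤ C * (N : ℝ) ^ (1 - γ) := by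
    calc (N : ℝ) * ‖L - ∑ n ∈ Finset.Icc 1 N, a n‖ ≤ N * (C * (N : ℝ) ^ (-γ)) := by
          gcongr
          refine (ha N).trans ?_
          gcongr C * ?_
          exact Real.rpow_le_rpow_of_nonpos hN0 (by linarith) (by linarith)
      _ = C * ((N : ℝ) ^ (1 : ℝ) * (N : ℝ) ^ (-γ)) := by
        rw [Real.rpow_one]
        ring
      _ = _ := by
        rw [← Real.rpow_add hN0]
        ring_nf
  have h4 : ‖∑ n ∈ range N, (L - ∑ k ∈ Finset.Icc 1 n, a k)‖ ≤
      C * ((N : ℝ) ^ (1 - γ) / (1 - γ)) := by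
    refine (norm_sum_le_of_le _ fun n _ => ha n).trans ?_
    rw [← mul_sum]
    gcongr
    exact sum_range_add_one_rpow_neg_le h0 h1 N
  calc _ ≤ C * (N : ℝ) ^ (1 - γ) + C * ((N : ℝ) ^ (1 - γ) / (1 - γ)) := add_le_add h3 h4
    _ = _ := by ring

lemma tendsto_const_mul_natCast_rpow_neg (C : ℝ) {γ : ℝ} (hγ : 0 < γ) :
    Tendsto (fun N : ℕ => C * (N : ℝ) ^ (-γ)) atTop (nhds 0) := by
  simpa using ((tendsto_rpow_neg_atTop hγ).comp tendsto_natCast_atTop_atTop).const_mul C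

/-- The partial sums of `∑ c_n e(nx)`, `n ≥ 1`, approximate `f` to order `N ^ (-γ)`. -/
def ApproxOrder (c : ℕ → ℂ) (f : ℝ → ℂ) (γ : ℝ) : Prop :=
  ∃ C : ℝ, ∀ N : ℕ, N ≠ 0 → ∀ x : ℝ,
    ‖f x - ∑ n ∈ Finset.Icc 1 N, c n * e (n * x)‖ ≤ C * (N : ℝ) ^ (-γ)

lemma ApproxOrder.tendstoUniformly {c : ℕ → ℂ} {f : ℝ → ℂ} {γ : ℝ} (h : ApproxOrder c f γ)
    (hγ : 0 < γ) :
    TendstoUniformly (fun N x => ∑ n ∈ Finset.Icc 1 N, c n * e ((n : ℝ) * x)) f atTop := by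
  obtain ⟨C, hC⟩ := h
  rw [Metric.tendstoUniformly_iff]
  intro ε hε
  filter_upwards [(tendsto_const_mul_natCast_rpow_neg C hγ).eventually_lt_const hε,
    eventually_ne_atTop 0] with N hN hN0 x
  rw [dist_eq_norm]
  exact (hC N hN0 x).trans_lt hN

/-- The version of `ApproxOrder` that includes the empty partial sum. -/
lemma ApproxOrder.exists_add_one {c : ℕ → ℂ} {f : ℝ → ℂ} {γ : ℝ} (h : ApproxOrder c f γ)
    (h0 : 0 ≤ γ) (h1 : γ ≤ 1) :
    ∃ C : ℝ, 0 ≤ C ∧ ∀ (N : ℕ) (x : ℝ),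
      ‖f x - ∑ n ∈ Finset.Icc 1 N, c n * e (n * x)‖ ≤ C * ((N : ℝ) + 1) ^ (-γ) := by
  obtain ⟨C, hC⟩ := h
  have hC0 : 0 ≤ C := by
    have := (norm_nonneg _).trans (hC 1 one_ne_zero 0)
    simpa using this
  refine ⟨2 * C + ‖c 1‖, by positivity, fun N x => ?_⟩
  rcases eq_or_ne N 0 with rfl | hN
  · have h2 := hC 1 one_ne_zero x
    simp only [Finset.Icc_self, sum_singleton, Nat.cast_one, one_mul, Real.one_rpow,
      mul_one] at h2
    have h3 := norm_add_le (f x - c 1 * e x) (c 1 * e x)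
    rw [sub_add_cancel, norm_mul, norm_e, mul_one] at h3
    simp
    linarith
  · have hN1 : (1 : ℝ) ≤ N := by exact_mod_cast Nat.one_le_iff_ne_zero.2 hN
    have hN0 : (0 : ℝ) < N := by linarith
    have h2 : (N : ℝ) ^ (-γ) ≤ 2 * ((N : ℝ) + 1) ^ (-γ) := by
      have h3 : (2 * (N : ℝ)) ^ (-γ) ≤ ((N : ℝ) + 1) ^ (-γ) :=
        Real.rpow_le_rpow_of_nonpos (by linarith) (by linarith) (by linarith)
      rw [Real.mul_rpow zero_le_two hN0.le] at h3
      have h4 : (2 : ℝ)⁻¹ ≤ 2 ^ (-γ) := by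
        rw [← Real.rpow_neg_one]
        exact Real.rpow_le_rpow_of_exponent_le one_le_two (by linarith)
      have h5 : 0 < (N : ℝ) ^ (-γ) := Real.rpow_pos_of_pos hN0 _
      nlinarith
    calc _ ≤ C * (N : ℝ) ^ (-γ) := hC N hN x
      _ ≤ C * (2 * ((N : ℝ) + 1) ^ (-γ)) := by gcongr
      _ = 2 * C * ((N : ℝ) + 1) ^ (-γ) := by ring
      _ ≤ _ := by
        gcongr
        exact le_add_of_nonneg_right (norm_nonneg _)

lemma hasDerivAt_e_mul (a x : ℝ) :
    HasDerivAt (fun x : ℝ => e (a * x)) (2 * Real.pi * Complex.I * a * e (a * x)) x := by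
  have h : HasDerivAt (fun x : ℝ => 2 * Real.pi * Complex.I * ((a * x : ℝ) : ℂ))
      (2 * Real.pi * Complex.I * a) x := by
    have := (((hasDerivAt_id x).const_mul a).ofReal_comp).const_mul (2 * Real.pi * Complex.I : ℂ)
    simpa using this
  rw [mul_comm _ (e _)]
  exact h.cexp

lemma norm_sum_e_sub_sum_e_le (c : ℕ → ℂ) (N : ℕ) {B : ℝ}
    (hB : ∀ x : ℝ, ‖∑ n ∈ Finset.Icc 1 N, (n : ℂ) * (c n * e (n * x))‖ ≤ B) (x y : ℝ) :
    ‖(∑ n ∈ Finset.Icc 1 N, c n * e (n * x)) - ∑ n ∈ Finset.Icc 1 N, c n * e (n * y)‖ ≤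
      2 * Real.pi * B * |x - y| := by
  have hd : ∀ z : ℝ, HasDerivAt (fun z : ℝ => ∑ n ∈ Finset.Icc 1 N, c n * e (n * z))
      (2 * Real.pi * Complex.I * ∑ n ∈ Finset.Icc 1 N, (n : ℂ) * (c n * e (n * z))) z := by
    intro z
    rw [mul_sum]
    refine HasDerivAt.fun_sum fun n _ => ?_
    refine ((hasDerivAt_e_mul n z).const_mul (c n)).congr_deriv ?_
    push_cast
    ring
  refine Convex.norm_image_sub_le_of_norm_hasDerivWithin_le (s := Set.univ)
    (fun z _ => (hd z).hasDerivWithinAt) (fun z _ => ?_) convex_univ (Set.mem_univ y)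
    (Set.mem_univ x)
  rw [norm_mul]
  have : ‖(2 * Real.pi * Complex.I : ℂ)‖ = 2 * Real.pi := by
    simp [abs_of_pos Real.pi_pos]
  rw [this]
  gcongr
  exact hB z

lemma ApproxOrder.holder {c : ℕ → ℂ} {f : ℝ → ℂ} {γ : ℝ} (h : ApproxOrder c f γ)
    (h0 : 0 < γ) (h1 : γ < 1) :
    ∃ C > (0 : ℝ), ∀ x y : ℝ, ‖f x - f y‖ ≤ C * |x - y| ^ γ := by
  obtain ⟨C, hC0, hC⟩ := h.exists_add_one h0.le h1.le
  obtain ⟨D, hD⟩ : ∃ D, D = C * (1 + 1 / (1 - γ)) := ⟨_, rfl⟩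
  have hD0 : 0 ≤ D := by
    have : 0 < 1 - γ := by linarith
    rw [hD]
    positivity
  have hpi := Real.pi_pos
  refine ⟨2 * C + 4 * Real.pi * D + 1, by positivity, fun x y => ?_⟩
  obtain ⟨d, hd⟩ : ∃ d, d = |x - y| := ⟨_, rfl⟩
  rw [← hd]
  have hd0 : 0 ≤ d := hd ▸ abs_nonneg _
  rcases hd0.eq_or_lt with hz | hpos
  · have : x = y := by
      rw [← sub_eq_zero, ← abs_eq_zero, ← hd, hz]
    simp only [this, sub_self, norm_zero]
    positivity
  have htri : ∀ N : ℕ, ‖f x - f y‖ ≤ 2 * C * ((N : ℝ) + 1) ^ (-γ) +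
      ‖(∑ n ∈ Finset.Icc 1 N, c n * e (n * x)) - ∑ n ∈ Finset.Icc 1 N, c n * e (n * y)‖ := by
    intro N
    have e1 : f x - f y = (f x - ∑ n ∈ Finset.Icc 1 N, c n * e (n * x)) -
        (f y - ∑ n ∈ Finset.Icc 1 N, c n * e (n * y)) +
        ((∑ n ∈ Finset.Icc 1 N, c n * e (n * x)) - ∑ n ∈ Finset.Icc 1 N, c n * e (n * y)) := by
      ring
    rw [e1]
    refine (norm_add_le _ _).trans (add_le_add_left ?_ _)
    refine (norm_sub_le _ _).trans ?_
    linarith [hC N x, hC N y]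
  have hdγ : 0 < d ^ γ := Real.rpow_pos_of_pos hpos _
  rcases le_total 1 d with h1d | hd1
  · have h2 := htri 0
    have h3 : 1 ≤ d ^ γ := Real.one_le_rpow h1d h0.le
    simp only [Nat.cast_zero, zero_add, Real.one_rpow, mul_one, Finset.Icc_eq_empty_of_lt one_pos,
      sum_empty, sub_self, norm_zero, add_zero] at h2
    have : 0 ≤ 4 * Real.pi * D := by positivity
    nlinarith
  · obtain ⟨N, hN⟩ : ∃ N, N = ⌈d⁻¹⌉₊ := ⟨_, rfl⟩
    have hdi : 1 ≤ d⁻¹ := (one_le_inv₀ hpos).2 hd1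
    have hN1 : d⁻¹ ≤ N := hN ▸ Nat.le_ceil _
    have hN2 : (N : ℝ) ≤ 2 * d⁻¹ := by
      have := Nat.ceil_lt_add_one (inv_nonneg.2 hd0)
      rw [← hN] at this
      linarith
    have hN0 : N ≠ 0 := by
      rintro rfl
      simp only [Nat.cast_zero] at hN1
      linarith
    have h2 : ((N : ℝ) + 1) ^ (-γ) ≤ d ^ γ := by
      refine (Real.rpow_le_rpow_of_nonpos (by positivity) (by linarith : d⁻¹ ≤ (N : ℝ) + 1)
        (by linarith)).trans_eq ?_
      rw [Real.inv_rpow hd0, Real.rpow_neg hd0, inv_inv]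
    have h3 : (N : ℝ) ^ (1 - γ) * d ≤ 2 * d ^ γ := by
      have h4 : (N : ℝ) ^ (1 - γ) ≤ (2 * d⁻¹) ^ (1 - γ) := by
        gcongr
      rw [Real.mul_rpow zero_le_two (by positivity), Real.inv_rpow hd0, ← Real.rpow_neg hd0] at h4
      have h5 : (2 : ℝ) ^ (1 - γ) ≤ 2 := by
        conv_rhs => rw [← Real.rpow_one 2]
        exact Real.rpow_le_rpow_of_exponent_le one_le_two (by linarith)
      have h6 : d ^ (-(1 - γ)) * d = d ^ γ := by
        nth_rewrite 2 [← Real.rpow_one d]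
        rw [← Real.rpow_add hpos]
        ring_nf
      calc (N : ℝ) ^ (1 - γ) * d ≤ (2 ^ (1 - γ) * d ^ (-(1 - γ))) * d := by gcongr
        _ = 2 ^ (1 - γ) * d ^ γ := by rw [mul_assoc, h6]
        _ ≤ _ := by gcongr
    have h7 := norm_sum_e_sub_sum_e_le c N (B := D * (N : ℝ) ^ (1 - γ)) (fun z => by
      rw [hD]
      exact norm_sum_Icc_natCast_mul_le h0.le h1 (fun n => hC n z) hN0) x y
    rw [← hd] at h7
    calc ‖f x - f y‖ ≤ 2 * C * ((N : ℝ) + 1) ^ (-γ) +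
          2 * Real.pi * (D * (N : ℝ) ^ (1 - γ)) * d := (htri N).trans (by linarith)
      _ = 2 * C * ((N : ℝ) + 1) ^ (-γ) + 2 * Real.pi * D * ((N : ℝ) ^ (1 - γ) * d) := by ring
      _ ≤ 2 * C * d ^ γ + 2 * Real.pi * D * (2 * d ^ γ) := by gcongr
      _ ≤ _ := by linarith

/-- A uniformly convergent series `∑ c_n e(nx)`, `n ≥ 1`, has a sum in `C^{<α}` if and only if its
partial sums approximate the sum to every order below `α`. -/
lemma exists_holder_iff_exists_approxOrder {α : ℝ} (h0 : 0 < α) (h1 : α ≤ 1) (c : ℕ → ℂ) :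
    (∃ f : ℝ → ℂ,
      TendstoUniformly
        (fun N x => ∑ n ∈ Finset.Icc 1 N, c n * e ((n : ℝ) * x)) f Filter.atTop ∧
      ∀ β' : ℝ, 0 < β' → β' < α → ∃ C > (0:ℝ), ∀ x y : ℝ,
        ‖f x - f y‖ ≤ C * |x - y| ^ β') ↔
    ∃ f : ℝ → ℂ, ∀ γ : ℝ, 0 < γ → γ < α → ApproxOrder c f γ := by
  constructor
  · rintro ⟨f, hf, hH⟩
    refine ⟨f, fun γ hγ0 hγα => ?_⟩
    obtain ⟨H, -, hH⟩ := hH ((γ + α) / 2) (by linarith) (by linarith)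
    exact exists_norm_sub_sum_le_of_holder hf hγ0 (by linarith) (by linarith) hH
  · rintro ⟨f, hf⟩
    exact ⟨f, (hf (α / 2) (by linarith) (by linarith)).tendstoUniformly (by linarith),
      fun γ hγ0 hγα => (hf γ hγ0 hγα).holder hγ0 (by linarith)⟩

/-- Multiplication of the coefficients by `n ^ s` lowers the order of approximation by `s`. -/
lemma exists_approxOrder_mul_rpow {α s : ℝ} (h0 : 0 < α) (hs : |s| ≤ 1) (hsα : s < α)
    {c : ℕ → ℂ} (h : ∃ f : ℝ → ℂ, ∀ γ : ℝ, 0 < γ → γ < α → ApproxOrder c f γ) :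
    ∃ g : ℝ → ℂ, ∀ γ : ℝ, 0 < γ → γ < α - s →
      ApproxOrder (fun n => c n * (((n : ℝ) ^ s : ℝ) : ℂ)) g γ := by
  obtain ⟨f, hf⟩ := h
  have key : ∀ γ : ℝ, 0 < γ → γ < α - s → ∃ C : ℝ, ∀ M N : ℕ, M ≠ 0 → M ≤ N → ∀ x : ℝ,
      ‖(∑ n ∈ Finset.Icc 1 N, c n * (((n : ℝ) ^ s : ℝ) : ℂ) * e (n * x)) -
        ∑ n ∈ Finset.Icc 1 M, c n * (((n : ℝ) ^ s : ℝ) : ℂ) * e (n * x)‖ ≤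
        C * (M : ℝ) ^ (-γ) := by
    intro γ hγ0 hγ
    obtain ⟨γ₁, hγ₁⟩ : ∃ γ₁, γ₁ = max (γ + s) (max (α / 2) ((α + s) / 2)) := ⟨_, rfl⟩
    have ha : γ + s ≤ γ₁ := hγ₁ ▸ le_max_left _ _
    have hb : α / 2 ≤ γ₁ := hγ₁ ▸ (le_max_left _ _).trans (le_max_right _ _)
    have hc : γ₁ < α := by
      rw [hγ₁]
      refine max_lt (by linarith) (max_lt (by linarith) (by linarith))
    obtain ⟨C, hC⟩ := hf γ₁ (by linarith) hc
    have hC0 : 0 ≤ C := by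
      have := (norm_nonneg _).trans (hC 1 one_ne_zero 0)
      simpa using this
    have hs1 : 0 < γ₁ - s := by linarith
    refine ⟨C * (2 + (2 + (γ₁ - s)) / (γ₁ - s)), fun M N hM hMN x => ?_⟩
    have h2 := norm_sum_Ioc_rpow_mul_le hs (by linarith : s < γ₁) (fun n hn => hC n hn x) hM hMN
    have h3 : (∑ n ∈ Finset.Icc 1 N, c n * (((n : ℝ) ^ s : ℝ) : ℂ) * e (n * x)) -
        ∑ n ∈ Finset.Icc 1 M, c n * (((n : ℝ) ^ s : ℝ) : ℂ) * e (n * x) =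
        ∑ n ∈ Ioc M N, (((n : ℝ) ^ s : ℝ) : ℂ) * (c n * e (n * x)) := by
      rw [sub_eq_iff_eq_add', ← Ioc_zero_eq_Icc_one, ← Ioc_zero_eq_Icc_one,
        ← sum_Ioc_consecutive _ M.zero_le hMN]
      congr 1
      refine sum_congr rfl fun n _ => ?_
      ring
    rw [h3]
    refine h2.trans ?_
    have hM1 : (1 : ℝ) ≤ M := by exact_mod_cast Nat.one_le_iff_ne_zero.2 hM
    gcongr
    linarith
  have hlim : ∀ x : ℝ, ∃ L : ℂ, Tendsto (fun N : ℕ => ∑ n ∈ Finset.Icc 1 N,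
      c n * (((n : ℝ) ^ s : ℝ) : ℂ) * e (n * x)) atTop (nhds L) := by
    intro x
    refine cauchySeq_tendsto_of_complete (Metric.cauchySeq_iff'.2 fun ε hε => ?_)
    obtain ⟨C, hC⟩ := key ((α - s) / 2) (by linarith) (by linarith)
    obtain ⟨M, hM, hM0⟩ := (((tendsto_const_mul_natCast_rpow_neg C
      (by linarith : 0 < (α - s) / 2)).eventually_lt_const hε).and (eventually_ne_atTop 0)).exists
    refine ⟨M, fun N hN => ?_⟩
    rw [dist_eq_norm]
    exact (hC M N hM0 hN x).trans_lt hM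
  choose g hg using hlim
  refine ⟨g, fun γ hγ0 hγ => ?_⟩
  obtain ⟨C, hC⟩ := key γ hγ0 hγ
  refine ⟨C, fun M hM x => ?_⟩
  refine le_of_tendsto ((hg x).sub_const _).norm ?_
  filter_upwards [eventually_ge_atTop M] with N hN
  exact hC M N hM hN x

/-- Compatibility of the class `C^{<α}` with fractional differentiation of order
`β` (positive-frequency part): `∑ c_n e(nx) ∈ C^{<α}` iff
`∑ c_n n^β e(nx) ∈ C^{<α-β}`. -/
theorem stmt_17 (α β : ℝ) (hβ : 0 < β) (hβα : β < α) (hα : α ≤ 1) (c : ℕ → ℂ) :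
    (∃ f : ℝ → ℂ,
      TendstoUniformly
        (fun N x => ∑ n ∈ Finset.Icc 1 N, c n * e ((n : ℝ) * x)) f Filter.atTop ∧
      ∀ β' : ℝ, 0 < β' → β' < α → ∃ C > (0:ℝ), ∀ x y : ℝ,
        ‖f x - f y‖ ≤ C * |x - y| ^ β') ↔
    (∃ g : ℝ → ℂ,
      TendstoUniformly
        (fun N x => ∑ n ∈ Finset.Icc 1 N,
          c n * (((n : ℝ) ^ β : ℝ) : ℂ) * e ((n : ℝ) * x)) g Filter.atTop ∧
      ∀ β' : ℝ, 0 < β' → β' < α - β → ∃ C > (0:ℝ), ∀ x y : ℝ,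
        ‖g x - g y‖ ≤ C * |x - y| ^ β') := by
  rw [exists_holder_iff_exists_approxOrder (hβ.trans hβα) hα,
    exists_holder_iff_exists_approxOrder (sub_pos.2 hβα) (by linarith)
      (fun n => c n * (((n : ℝ) ^ β : ℝ) : ℂ))]
  refine ⟨exists_approxOrder_mul_rpow (hβ.trans hβα) (abs_le.2 ⟨by linarith, by linarith⟩) hβα,
    fun h => ?_⟩
  obtain ⟨f, hf⟩ := exists_approxOrder_mul_rpow (s := -β) (sub_pos.2 hβα)
    (abs_le.2 ⟨by linarith, by linarith⟩) (by linarith) h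
  refine ⟨f, fun γ hγ0 hγ => ?_⟩
  obtain ⟨C, hC⟩ := hf γ hγ0 (by linarith)
  refine ⟨C, fun N hN x => ?_⟩
  have hsum : ∑ n ∈ Finset.Icc 1 N, c n * e (n * x) =
      ∑ n ∈ Finset.Icc 1 N,
        c n * (((n : ℝ) ^ β : ℝ) : ℂ) * (((n : ℝ) ^ (-β) : ℝ) : ℂ) * e (n * x) := by
    refine sum_congr rfl fun n hn => ?_
    have hn0 : (0 : ℝ) < n := by
      rw [Finset.mem_Icc] at hn
      exact_mod_cast hn.1
    rw [mul_assoc (c n), ← Complex.ofReal_mul, ← Real.rpow_add hn0, add_neg_cancel,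
      Real.rpow_zero, Complex.ofReal_one, mul_one]
  rw [hsum]
  exact hC N hN x
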